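/- For every r ∈ (0,1), one has 0 < g₁(r) < δ, where g₁(r) = g(r)/r² and δ = 128/5 − 32 log 2 − 17π/2 + 5π²/2. -/

import Mathlib

open Real Set Filter Topology

/-- The complete elliptic integral of the first kind. -/
noncomputable def K (r : ℝ) : ℝ :=
  ∫ t in (0:ℝ)..(π/2), (1 - r^2 * Real.sin t ^ 2) ^ (-(1:ℝ)/2)

/-- `lam = 8/5 - log 4`. -/
noncomputable def lam : ℝ := 8/5 - Real.log 4

noncomputable def g (r : ℝ) : ℝ :=
  (lam * r^2 + K r) * (16 + (5*π - 16) * r^2) - (π/2) * (16 - 5 * Real.log (1 - r^2))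

noncomputable def g₁ (r : ℝ) : ℝ := g r / r^2

/-- Wallis ratio. -/
noncomputable def bb (n : ℕ) : ℝ := ∏ i ∈ Finset.range n, (2 * (i : ℝ) + 1) / (2 * i + 2)

lemma bb_zero : bb 0 = 1 := by simp [bb]
lemma bb_succ (n : ℕ) : bb (n+1) = bb n * ((2 * (n : ℝ) + 1) / (2 * n + 2)) := by
  simp only [bb, Finset.prod_range_succ]

lemma bb_pos (n : ℕ) : 0 < bb n := Finset.prod_pos fun i _ => by positivity

lemma bb_sq_W (n : ℕ) : bb n ^ 2 * (2 * n + 1) * Real.Wallis.W n = 1 := by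
  induction n with
  | zero => simp [bb, Real.Wallis.W]
  | succ k ih =>
    rw [bb_succ, Real.Wallis.W_succ]
    push_cast
    have h1 : (2 * (k:ℝ) + 1) ≠ 0 := by positivity
    have h3 : (2 * (k:ℝ) + 3) ≠ 0 := by positivity
    have h2 : (2 * (k:ℝ) + 2) ≠ 0 := by positivity
    refine Eq.trans ?_ ih
    field_simp
    ring

lemma bb_sq_lt (n : ℕ) (hn : 1 ≤ n) : π * bb n ^ 2 * n < 1 := by
  have h := Real.Wallis.le_W n
  have hw := bb_sq_W n
  have hn' : (1:ℝ) ≤ n := by exact_mod_cast hn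
  have hb := bb_pos n
  have h1 : bb n ^ 2 * (2 * n + 1) * (((2 : ℝ) * n + 1) / (2 * n + 2) * (π / 2)) ≤ 1 := by
    refine le_trans ?_ hw.le
    gcongr
  have h2 : bb n ^ 2 * (2 * n + 1) * (((2 : ℝ) * n + 1) / (2 * n + 2) * (π / 2))
     = π * bb n ^ 2 * n + π * bb n ^ 2 / (4 * (n+1)) := by
    field_simp
    ring
  have h3 : 0 < π * bb n ^ 2 / (4 * (n+1)) := by positivity
  linarith

lemma choose_bb (n : ℕ) : Ring.choose (-(1:ℝ)/2) n = (-1)^n * bb n := by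
  rw [Ring.choose_eq_smul]
  induction n with
  | zero => simp [bb]
  | succ k ih =>
    rw [bb_succ, descPochhammer_succ_right, Polynomial.smeval_mul, pow_succ, Nat.factorial_succ]
    have : (-1:ℝ)^k * -1 * (bb k * ((2 * (k : ℝ) + 1) / (2 * k + 2))) =
      ((-1)^k * bb k) * (-((2 * (k : ℝ) + 1) / (2 * k + 2))) := by ring
    rw [this, ← ih]
    simp only [Polynomial.smeval_sub, Polynomial.smeval_X, Polynomial.smeval_natCast, smul_eq_mul]
    have h2 : (2 * (k:ℝ) + 2) ≠ 0 := by positivity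
    have h4 : ((k:ℝ) + 1) ≠ 0 := by positivity
    have h3 : ((k.factorial:ℝ)) ≠ 0 := by positivity
    push_cast
    field_simp
    simp
    ring

lemma hasSum_rpow {y : ℝ} (hy : |y| < 1) :
    HasSum (fun n => bb n * y ^ n) ((1 - y) ^ (-(1:ℝ)/2)) := by
  have h := (Real.one_add_rpow_hasFPowerSeriesOnBall_zero (a := -(1:ℝ)/2)).hasSum (y := -y)
    (by simpa [enorm_eq_nnnorm, ← NNReal.coe_lt_coe] using hy)
  simp only [zero_add, binomialSeries_apply, choose_bb] at h
  rw [sub_eq_add_neg]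
  convert! h using 1
  funext n
  simp only [List.ofFn_const, List.prod_replicate, smul_eq_mul]
  rw [neg_pow y]
  have : (-1:ℝ)^n * (-1)^n = 1 := by rw [← mul_pow]; simp
  linear_combination (- bb n * y ^n) * this

lemma int_sin (n : ℕ) : ∫ t in (0:ℝ)..(π/2), Real.sin t ^ (2*n) = π/2 * bb n := by
  induction n with
  | zero => simp [bb]
  | succ k ih =>
    rw [mul_add, mul_one, integral_sin_pow, ih, bb_succ]
    simp
    ring

lemma K_hasSum {r : ℝ} (hr : r ∈ Ioo (0:ℝ) 1) :
    HasSum (fun n => π/2 * bb n ^ 2 * (r^2)^n) (K r) := by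
  obtain ⟨h0, h1⟩ := hr
  have hx : r^2 < 1 := by nlinarith
  have hx0 : 0 ≤ r^2 := sq_nonneg r
  have hs := fun t : ℝ => Real.sin_sq_le_one t
  have key := intervalIntegral.hasSum_integral_of_dominated_convergence (μ := MeasureTheory.volume)
    (a := 0) (b := π/2)
    (F := fun n t => bb n * (r^2 * Real.sin t ^2)^n)
    (f := fun t => (1 - r^2 * Real.sin t ^ 2) ^ (-(1:ℝ)/2)) (fun n _ => bb n * (r^2)^n)
    (fun n => (by fun_prop : Continuous _).aestronglyMeasurable)
    (fun n => Eventually.of_forall fun t _ => ?_)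
    (Eventually.of_forall fun t _ => (hasSum_rpow (by rwa [abs_of_nonneg hx0])).summable)
    (by simp)
    (Eventually.of_forall fun t _ => hasSum_rpow ?_)
  · unfold K
    convert! key using 1
    funext n
    have : ∀ t, bb n * (r^2 * Real.sin t ^2)^n = (bb n * (r^2)^n) * Real.sin t ^(2*n) := by
      intro t; rw [mul_pow, pow_mul (Real.sin t)]; ring
    simp_rw [this]
    rw [intervalIntegral.integral_const_mul, int_sin]
    ring
  · have hb := (bb_pos n).le
    rw [norm_of_nonneg (by positivity)]
    gcongr
    nlinarith [hs t]
  · rw [abs_of_nonneg (by positivity)]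
    nlinarith [hs t, sq_nonneg (Real.sin t)]

/-- Series coefficients. -/
noncomputable def ee (n : ℕ) : ℝ :=
  π/2 * (16 * bb (n+2) ^ 2 + (5*π - 16) * bb (n+1) ^ 2 - 5 / ((n:ℝ)+2))

lemma c_neg : 5*π - 16 < 0 := by linarith [Real.pi_lt_d2]

lemma lam_pos : 0 < lam := by
  have : Real.log 4 = 2 * Real.log 2 := by
    rw [show (4:ℝ) = 2^2 by norm_num, Real.log_pow]; norm_num
  unfold lam
  linarith [Real.log_two_lt_d9]

lemma ee_neg (n : ℕ) : ee n < 0 := by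
  have h := bb_sq_lt (n+2) (by omega)
  push_cast at h
  have hb : bb (n+2) ≤ bb (n+1) := by
    rw [bb_succ (n+1)]
    apply mul_le_of_le_one_right (bb_pos _).le
    rw [div_le_one (by positivity)]
    linarith
  have hb2 : bb (n+2) ^ 2 ≤ bb (n+1) ^ 2 := by
    have := bb_pos (n+2)
    gcongr
  have h1 : (5*π - 16) * bb (n+1) ^ 2 ≤ (5*π - 16) * bb (n+2) ^ 2 :=
    mul_le_mul_of_nonpos_left hb2 c_neg.le
  have h2 : 5 * (π * bb (n+2) ^ 2) < 5 / ((n:ℝ)+2) := by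
    rw [lt_div_iff₀ (by positivity)]
    linarith
  unfold ee
  apply mul_neg_of_pos_of_neg (by positivity)
  linarith

lemma g₁_hasSum {r : ℝ} (hr : r ∈ Ioo (0:ℝ) 1) :
    HasSum (fun n => ee n * (r^2)^(n+1))
      (g₁ r - (128/5 - 32 * Real.log 2 - 17*π/2 + 5*π^2/2) - lam * (5*π-16) * r^2) := by
  have hK := K_hasSum hr
  obtain ⟨h0, h1⟩ := hr
  have hx : r^2 < 1 := by nlinarith
  have hx0 : 0 < r^2 := by positivity
  have hL := Real.hasSum_pow_div_log_of_abs_lt_one (x := r^2) (by rwa [abs_of_pos hx0])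
  have hK2 := (hasSum_nat_add_iff' 2).2 hK
  have hK1 := (hasSum_nat_add_iff' 1).2 hK
  have hL1 := (hasSum_nat_add_iff' 1).2 hL
  have H := (((hK2.mul_left 16).add (hK1.mul_left ((5*π-16) * r^2))).sub
    (hL1.mul_left (5*π/2))).mul_left (r^2)⁻¹
  have hl : Real.log 4 = 2 * Real.log 2 := by
    rw [show (4:ℝ) = 2^2 by norm_num, Real.log_pow]; norm_num
  convert! H using 1
  · funext n
    unfold ee
    push_cast
    have : (n:ℝ) + 2 ≠ 0 := by positivity
    have : (n:ℝ) + 1 + 1 ≠ 0 := by positivity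
    field_simp
    ring
  · simp only [Finset.sum_range_succ, Finset.sum_range_zero, bb_succ, bb_zero, g₁, g, lam, hl]
    push_cast
    field_simp
    ring

lemma g₁_anti {r s : ℝ} (hr : r ∈ Ioo (0:ℝ) 1) (hs : s ∈ Ioo (0:ℝ) 1) (hrs : r < s) :
    g₁ s < g₁ r := by
  have h1 := g₁_hasSum hr
  have h2 := g₁_hasSum hs
  have hsq : r^2 < s^2 := by nlinarith [hr.1, hs.1]
  have := hasSum_le (fun n => mul_le_mul_of_nonpos_left
    (pow_le_pow_left₀ (sq_nonneg r) hsq.le (n+1)) (ee_neg n).le) h2 h1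
  nlinarith [mul_pos lam_pos (sub_pos.2 hsq), c_neg, mul_neg_of_pos_of_neg (mul_pos lam_pos (sub_pos.2 hsq)) c_neg]

lemma g₁_upper {r : ℝ} (hr : r ∈ Ioo (0:ℝ) 1) :
    g₁ r < (128/5 - 32 * Real.log 2 - 17*π/2 + 5*π^2/2) := by
  have h1 := g₁_hasSum hr
  have := h1.nonpos (fun n => mul_nonpos_of_nonpos_of_nonneg (ee_neg n).le (by positivity))
  have h3 : 0 < r^2 := by have := hr.1; positivity
  linarith [mul_neg_of_neg_of_pos (mul_neg_of_pos_of_neg lam_pos c_neg) h3]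

/-- Remainder integral. -/
noncomputable def JJ (r : ℝ) : ℝ :=
  ∫ t in (0:ℝ)..(π/2), (1 - Real.sin t) * (1 - r^2 * Real.sin t ^ 2) ^ (-(1:ℝ)/2)

lemma base_pos {r : ℝ} (hr : r ∈ Ioo (0:ℝ) 1) (t : ℝ) : 0 < 1 - r^2 * Real.sin t ^ 2 := by
  have : r^2 < 1 := by nlinarith [hr.1, hr.2]
  nlinarith [Real.sin_sq_le_one t, sq_nonneg (Real.sin t), sq_nonneg r]

lemma rpow_eq {y : ℝ} (hy : 0 < y) : y ^ (-(1:ℝ)/2) = 1 / √y := by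
  rw [show -(1:ℝ)/2 = -(1/2) by norm_num, Real.rpow_neg hy.le, ← Real.sqrt_eq_rpow, one_div]

lemma cont_base {r : ℝ} (hr : r ∈ Ioo (0:ℝ) 1) :
    Continuous fun t => (1 - r^2 * Real.sin t ^ 2) ^ (-(1:ℝ)/2) := by
  refine Continuous.rpow_const (by fun_prop) fun t => Or.inl (base_pos hr t).ne'

lemma int_first {r : ℝ} (hr : r ∈ Ioo (0:ℝ) 1) :
    ∫ t in (0:ℝ)..(π/2), Real.sin t * (1 - r^2 * Real.sin t ^ 2) ^ (-(1:ℝ)/2)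
      = Real.arsinh (r / √(1 - r^2)) / r := by
  have hx : 0 < 1 - r^2 := by nlinarith [hr.1, hr.2]
  have hr0 := hr.1
  have hd : ∀ t ∈ Set.uIcc (0:ℝ) (π/2),
      HasDerivAt (fun t => - (Real.arsinh (r * Real.cos t / √(1 - r^2)) / r))
        (Real.sin t * (1 - r^2 * Real.sin t ^ 2) ^ (-(1:ℝ)/2)) t := by
    intro t _
    have h := (((((Real.hasDerivAt_cos t).const_mul r).div_const (√(1 - r^2))).arsinh).div_const r).neg
    convert! h using 1
    rw [rpow_eq (base_pos hr t)]
    have e : 1 + (r * Real.cos t / √(1 - r^2))^2 = (1 - r^2 * Real.sin t ^ 2) / (1 - r^2) := by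
      rw [div_pow, Real.sq_sqrt hx.le, Real.sin_sq]
      field_simp
      ring
    rw [e, Real.sqrt_div (base_pos hr t).le]
    have h1 : √(1 - r^2) ≠ 0 := (Real.sqrt_pos.2 hx).ne'
    have h2 : √(1 - r^2 * Real.sin t ^ 2) ≠ 0 := (Real.sqrt_pos.2 (base_pos hr t)).ne'
    simp only [smul_eq_mul]
    field_simp
  rw [intervalIntegral.integral_eq_sub_of_hasDerivAt hd
    ((Real.continuous_sin.mul (cont_base hr)).intervalIntegrable _ _)]
  simp

lemma arsinh_val {r : ℝ} (hr : r ∈ Ioo (0:ℝ) 1) :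
    Real.arsinh (r / √(1 - r^2)) = Real.log (1 + r) - Real.log (1 - r^2) / 2 := by
  have hx : 0 < 1 - r^2 := by nlinarith [hr.1, hr.2]
  have hr0 := hr.1
  have e : 1 + (r / √(1 - r^2))^2 = 1 / (1 - r^2) := by
    rw [div_pow, Real.sq_sqrt hx.le]
    field_simp
    ring
  have h1 := Real.sqrt_pos.2 hx
  rw [Real.arsinh, e, Real.sqrt_div zero_le_one, Real.sqrt_one, ← add_div, Real.log_div (by positivity) h1.ne',
    Real.log_sqrt hx.le, add_comm]

lemma K_lower {r : ℝ} (hr : r ∈ Ioo (0:ℝ) 1) :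
    Real.log (1 + r) - Real.log (1 - r^2) / 2 + JJ r ≤ K r := by
  have h : K r = (∫ t in (0:ℝ)..(π/2), Real.sin t * (1 - r^2 * Real.sin t ^ 2) ^ (-(1:ℝ)/2)) + JJ r := by
    unfold K JJ
    have c0 := cont_base hr
    have c1 : Continuous fun t => Real.sin t * (1 - r^2 * Real.sin t ^ 2) ^ (-(1:ℝ)/2) :=
      Real.continuous_sin.mul c0
    have c2 : Continuous fun t => (1 - Real.sin t) * (1 - r^2 * Real.sin t ^ 2) ^ (-(1:ℝ)/2) :=
      (continuous_const.sub Real.continuous_sin).mul c0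
    rw [← intervalIntegral.integral_add (c1.intervalIntegrable _ _) (c2.intervalIntegrable _ _)]
    congr 1
    funext t
    ring
  rw [h, int_first hr, ← arsinh_val hr]
  have : 0 ≤ Real.arsinh (r / √(1 - r^2)) := Real.arsinh_nonneg_iff.2 (div_nonneg hr.1.le (Real.sqrt_nonneg _))
  have : Real.arsinh (r / √(1 - r^2)) ≤ Real.arsinh (r / √(1 - r^2)) / r :=
    le_div_self this hr.1 hr.2.le
  linarith

lemma int_log2 : ∫ t in (0:ℝ)..(π/2), Real.cos t / (1 + Real.sin t) = Real.log 2 := by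
  have hp : ∀ t ∈ Set.uIcc (0:ℝ) (π/2), 0 < 1 + Real.sin t := by
    intro t ht
    rw [Set.uIcc_of_le (by positivity)] at ht
    have := Real.sin_nonneg_of_nonneg_of_le_pi ht.1 (by linarith [ht.2, Real.pi_pos])
    linarith
  rw [intervalIntegral.integral_eq_sub_of_hasDerivAt (f := fun t => Real.log (1 + Real.sin t))]
  · simp; norm_num
  · intro t ht
    exact ((Real.hasDerivAt_sin t).const_add 1).log (hp t ht).ne'
  · apply ContinuousOn.intervalIntegrable
    apply ContinuousOn.div (by fun_prop) (by fun_prop)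
    intro t ht; exact (hp t ht).ne'

lemma JJ_tendsto : Tendsto JJ (𝓝[<] 1) (𝓝 (Real.log 2)) := by
  rw [← int_log2]
  have hev : ∀ᶠ r in 𝓝[<] (1:ℝ), r ∈ Ioo (0:ℝ) 1 := Ioo_mem_nhdsLT one_pos
  refine intervalIntegral.tendsto_integral_filter_of_dominated_convergence (fun _ => 1) ?_ ?_ ?_ ?_
  · filter_upwards [hev] with r hr
    exact ((continuous_const.sub Real.continuous_sin).mul (cont_base hr)).aestronglyMeasurable
  · filter_upwards [hev] with r hr
    refine Eventually.of_forall fun t ht => ?_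
    rw [Set.uIoc_of_le (by positivity)] at ht
    have hs0 := Real.sin_nonneg_of_nonneg_of_le_pi ht.1.le (by linarith [ht.2, Real.pi_pos])
    have hs1 := Real.sin_le_one t
    have hb := base_pos hr t
    rw [rpow_eq hb, Real.norm_of_nonneg (mul_nonneg (by linarith) (by positivity)), mul_one_div,
      div_le_one (Real.sqrt_pos.2 hb)]
    apply Real.le_sqrt_of_sq_le
    have : r^2 ≤ 1 := by nlinarith [hr.1, hr.2]
    nlinarith [mul_nonneg (sub_nonneg.2 this) (sq_nonneg (Real.sin t))]
  · simp
  · have hne : ∀ᵐ t : ℝ, t ≠ π/2 := by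
      simp [MeasureTheory.ae_iff]
    filter_upwards [hne] with t htne ht
    rw [Set.uIoc_of_le (by positivity)] at ht
    have hs0 := Real.sin_nonneg_of_nonneg_of_le_pi ht.1.le (by linarith [ht.2, Real.pi_pos])
    have hc : 0 < Real.cos t := Real.cos_pos_of_mem_Ioo ⟨by linarith [ht.1, Real.pi_pos], lt_of_le_of_ne ht.2 htne⟩
    have e : 1 - (1:ℝ)^2 * Real.sin t ^ 2 = Real.cos t ^ 2 := by
      rw [Real.cos_sq']; ring
    have hval : Real.cos t / (1 + Real.sin t)
        = (1 - Real.sin t) * (1 - (1:ℝ)^2 * Real.sin t ^ 2) ^ (-(1:ℝ)/2) := by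
      rw [rpow_eq (by rw [e]; positivity), e, Real.sqrt_sq hc.le, mul_one_div, div_eq_div_iff (by positivity) hc.ne']
      nlinarith [Real.sin_sq_add_cos_sq t]
    rw [hval]
    apply tendsto_nhdsWithin_of_tendsto_nhds
    have : ContinuousAt (fun r : ℝ => (1 - Real.sin t) * (1 - r^2 * Real.sin t ^ 2) ^ (-(1:ℝ)/2)) 1 := by
      refine continuousAt_const.mul (ContinuousAt.rpow_const (by fun_prop) (Or.inl ?_))
      rw [e]; positivity
    exact this

/-- Lower comparison function. -/
noncomputable def hh (r : ℝ) : ℝ :=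
  (lam * r^2 + Real.log (1 + r) + JJ r) * (16 + (5*π - 16) * r^2) - 8*π
    + (5*π-16)/2 * ((1 - r^2) * Real.log (1 - r^2))

lemma hh_tendsto : Tendsto hh (𝓝[<] 1) (𝓝 0) := by
  have hl : Real.log 4 = 2 * Real.log 2 := by
    rw [show (4:ℝ) = 2^2 by norm_num, Real.log_pow]; norm_num
  have c : ∀ f : ℝ → ℝ, ContinuousAt f 1 → Tendsto f (𝓝[<] 1) (𝓝 (f 1)) :=
    fun f hf => tendsto_nhdsWithin_of_tendsto_nhds hf
  have h1 := c (fun r => lam * r^2 + Real.log (1 + r))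
    (by
      refine ContinuousAt.add (by fun_prop) (ContinuousAt.log (by fun_prop) (by norm_num)))
  have h2 := c (fun r => 16 + (5*π - 16) * r^2) (by fun_prop)
  have h3 := c (fun r => (5*π-16)/2 * ((1 - r^2) * Real.log (1 - r^2)))
    (by
      refine ContinuousAt.mul (by fun_prop) ?_
      exact (Real.continuous_mul_log.comp (by fun_prop : Continuous fun r : ℝ => 1 - r^2)).continuousAt)
  have H := (((h1.add JJ_tendsto).mul h2).sub_const (8*π)).add h3
  have e : (lam * 1^2 + Real.log (1 + 1) + Real.log 2) * (16 + (5*π - 16) * 1^2) - 8*π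
    + (5*π-16)/2 * ((1 - 1^2) * Real.log (1 - 1^2)) = 0 := by
    rw [lam, hl, show (1:ℝ)+1 = 2 by norm_num]
    norm_num
    ring
  rw [← e]
  exact H

lemma hh_le {r : ℝ} (hr : r ∈ Ioo (0:ℝ) 1) : hh r ≤ g r := by
  have h := K_lower hr
  have hx : r^2 < 1 := by nlinarith [hr.1, hr.2]
  have hc : 0 ≤ 16 + (5*π - 16) * r^2 := by
    nlinarith [Real.pi_gt_three, sq_nonneg r]
  have := mul_le_mul_of_nonneg_right h hc
  unfold hh g
  linarith

lemma g₁_nonneg {r : ℝ} (hr : r ∈ Ioo (0:ℝ) 1) : 0 ≤ g₁ r := by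
  have ht : Tendsto (fun s => hh s / s^2) (𝓝[<] 1) (𝓝 (0 / 1^2)) :=
    hh_tendsto.div (tendsto_nhdsWithin_of_tendsto_nhds
      (by fun_prop : Continuous fun s : ℝ => s^2).continuousAt) (by norm_num)
  rw [zero_div] at ht
  refine le_of_tendsto ht ?_
  filter_upwards [Ioo_mem_nhdsLT hr.2] with s hs
  have hs' : s ∈ Ioo (0:ℝ) 1 := ⟨hr.1.trans hs.1, hs.2⟩
  refine le_trans ?_ (g₁_anti hr hs' hs.1).le
  unfold g₁
  exact div_le_div_of_nonneg_right (hh_le hs') (sq_nonneg s)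

theorem g₁_bounds (r : ℝ) (hr : r ∈ Ioo (0:ℝ) 1) :
    0 < g₁ r ∧ g₁ r < (128/5 - 32 * Real.log 2 - 17*π/2 + 5*π^2/2) := by
  refine ⟨?_, g₁_upper hr⟩
  obtain ⟨s, hs1, hs2⟩ := exists_between hr.2
  have hs : s ∈ Ioo (0:ℝ) 1 := ⟨hr.1.trans hs1, hs2⟩
  exact (g₁_nonneg hs).trans_lt (g₁_anti hr hs hs1)
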